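/- Let 0 < σ ≤ 1, q = np/(n − σp), α = (1−σ)q/p, and λ* = (1−α)(n−1−α(p−1)). Let U : (0,∞) → (0,∞) be of class C³ with U' < 0, solving −(r^{n−1}|U'(r)|^{p−2}U'(r))' = r^{n−1+(σ−1)q} U(r)^{q−1} on (0,∞) and given explicitly by U(r) = C w(r) with w(r) = (1 + r^{σ(n−p)q/(n(p−1))})^{−n/(σq)} and the appropriate constant C > 0; set f(r) = r^α U'(r). Let D ⊆ S^{n−1} be nonempty open and let g : ℝⁿ∖{0} → ℝ be C¹, positively 0-homogeneous, with g not identically zero on D, and suppose ∫_D |∇g|² dθ ≤ λ ∫_D g² dθ for some real λ with 0 ≤ λ < λ*. Then all the integrals below are finite and ∫_{Σ_D} |∇U(x)|^{p−2} [ (p−1) f'(|x|)² g(x)² + f(|x|)² |∇g(x)|² ] dx − (q−1) ∫_{Σ_D} |x|^{(σ−1)q} U(|x|)^{q−2} f(|x|)² g(x)² dx < 0, where U(x) abbreviates U(|x|). In particular, h(x) = f(|x|)g(x) is a direction of negative second variation of the energy functional at U. -/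

import Mathlib

open MeasureTheory ENNReal Set Filter Topology
open scoped RealInnerProductSpace NNReal

noncomputable section
attribute [local instance] Classical.propDecidable

abbrev Euc (n : ℕ) := EuclideanSpace ℝ (Fin n)

/-- The unit sphere `S^{n-1}` in `ℝ^n`. -/
def unitSphere (n : ℕ) : Set (Euc n) := Metric.sphere 0 1

/-- The open cone `Σ_D = {t y : y ∈ D, t > 0}` spanned by `D`. -/
def cone {n : ℕ} (D : Set (Euc n)) : Set (Euc n) :=
  {x | ∃ y ∈ D, ∃ t : ℝ, 0 < t ∧ x = t • y}

/-- `D` is an open subset of the unit sphere (in the relative topology). -/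
def IsOpenInSphere {n : ℕ} (D : Set (Euc n)) : Prop :=
  D ⊆ unitSphere n ∧ ∃ U : Set (Euc n), IsOpen U ∧ D = U ∩ unitSphere n

/-- `g` is the distributional gradient of `u` on the open set `Ω`. -/
def HasGradOn {n : ℕ} (Ω : Set (Euc n)) (u : Euc n → ℝ) (g : Euc n → Euc n) : Prop :=
  ∀ φ : Euc n → ℝ, ContDiff ℝ (⊤ : ℕ∞) φ → HasCompactSupport φ → tsupport φ ⊆ Ω →
    ∀ v : Euc n, (∫ x in Ω, u x * fderiv ℝ φ x v) = - ∫ x in Ω, ⟪g x, v⟫ * φ x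

/-- The weighted norm `‖ |x|^{σ-1} u ‖_{L_q(Ω)}`. -/
def wNorm {n : ℕ} (Ω : Set (Euc n)) (σ q : ℝ) (u : Euc n → ℝ) : ℝ≥0∞ :=
  eLpNorm (fun x => ‖x‖ ^ (σ - 1) * u x) (ENNReal.ofReal q) (volume.restrict Ω)

/-- The norm `‖g‖_{L_p(Ω)}` of a vector field. -/
def gradNorm {n : ℕ} (Ω : Set (Euc n)) (p : ℝ) (g : Euc n → Euc n) : ℝ≥0∞ :=
  eLpNorm g (ENNReal.ofReal p) (volume.restrict Ω)

/-- `u`, together with its distributional gradient `g`, belongs to `𝒟_p(Ω)`. -/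
def memD {n : ℕ} (Ω : Set (Euc n)) (p σ q : ℝ) (u : Euc n → ℝ) (g : Euc n → Euc n) : Prop :=
  HasGradOn Ω u g ∧ wNorm Ω σ q u < ⊤ ∧ gradNorm Ω p g < ⊤

/-- The Hardy–Sobolev quotient `Q^σ_Ω(u) = ‖∇u‖_p^p / ‖ |x|^{σ-1}u ‖_q^p`. -/
def HSquot {n : ℕ} (Ω : Set (Euc n)) (p σ q : ℝ) (u : Euc n → ℝ) (g : Euc n → Euc n) : ℝ :=
  (gradNorm Ω p g).toReal ^ p / (wNorm Ω σ q u).toReal ^ p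

/-- The sharp Hardy–Sobolev constant `S^σ_Ω`. -/
def HSconst {n : ℕ} (Ω : Set (Euc n)) (p σ q : ℝ) : ℝ :=
  sInf {c | ∃ u g, memD Ω p σ q u g ∧ wNorm Ω σ q u ≠ 0 ∧ c = HSquot Ω p σ q u g}

/-- The surface measure on the unit sphere, normalized so that the total mass of the
sphere is `n` times the volume of the unit ball. -/
def sphereMeasure (n : ℕ) : Measure (Euc n) :=
  (n : ℝ≥0∞) • Measure.map (fun x : Euc n => ‖x‖⁻¹ • x)
    (volume.restrict (Metric.ball (0 : Euc n) 1 \ {0}))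

/-- Near `y`, `Ω` is (in suitable local coordinates) the open region above the graph of a
Lipschitz function; in particular the boundary of `Ω` is a Lipschitz graph near `y`. -/
def IsLipschitzGraphDomainAt {n : ℕ} (Ω : Set (Euc n)) (y : Euc n) : Prop :=
  ∃ (ν : Euc n) (f : Euc n → ℝ) (L : ℝ≥0) (ε : ℝ), ‖ν‖ = 1 ∧ 0 < ε ∧ LipschitzWith L f ∧
    Ω ∩ Metric.ball y ε = {x | f (x - ⟪x, ν⟫ • ν) < ⟪x, ν⟫} ∩ Metric.ball y ε

/-- Near `y`, `Ω` is (in suitable local coordinates) the open region above the graph of a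
`C¹` function; in particular the boundary of `Ω` is a `C¹` graph near `y`. -/
def IsC1GraphDomainAt {n : ℕ} (Ω : Set (Euc n)) (y : Euc n) : Prop :=
  ∃ (ν : Euc n) (f : Euc n → ℝ) (ε : ℝ), ‖ν‖ = 1 ∧ 0 < ε ∧ ContDiff ℝ 1 f ∧
    Ω ∩ Metric.ball y ε = {x | f (x - ⟪x, ν⟫ • ν) < ⟪x, ν⟫} ∩ Metric.ball y ε

/-- `D ⊆ S^{n-1}` has strictly Lipschitz boundary: near each of its nonzero points, the
boundary of the cone `Σ_D` is the graph of a Lipschitz function in suitable coordinates. -/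
def StrictLipschitzBoundary {n : ℕ} (D : Set (Euc n)) : Prop :=
  ∀ y ∈ frontier (cone D), y ≠ 0 → IsLipschitzGraphDomainAt (cone D) y

/-- `D ⊆ S^{n-1}` has `C¹` boundary: near each of its nonzero points, the boundary of the
cone `Σ_D` is the graph of a `C¹` function in suitable coordinates. -/
def C1Boundary {n : ℕ} (D : Set (Euc n)) : Prop :=
  ∀ y ∈ frontier (cone D), y ≠ 0 → IsC1GraphDomainAt (cone D) y

/-- `g` is positively `0`-homogeneous away from the origin. -/
def IsZeroHomog {n : ℕ} (g : Euc n → ℝ) : Prop :=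
  ∀ t : ℝ, 0 < t → ∀ x : Euc n, x ≠ 0 → g (t • x) = g x

/-- The first nonzero Neumann eigenvalue of the Laplace–Beltrami operator on `D`,
defined variationally (test functions are realized as positively `0`-homogeneous `C¹`
functions on the closed cone minus the origin; their Euclidean gradient on the sphere is
the tangential gradient). -/
def lambdaOne {n : ℕ} (D : Set (Euc n)) : ℝ :=
  sInf {c | ∃ g : Euc n → ℝ, ContDiffOn ℝ 1 g (closure (cone D) \ {0}) ∧ IsZeroHomog g ∧
    (∫ x in D, g x ∂sphereMeasure n) = 0 ∧ (∫ x in D, (g x) ^ 2 ∂sphereMeasure n) ≠ 0 ∧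
    c = (∫ x in D, ‖gradient g x‖ ^ 2 ∂sphereMeasure n) /
        (∫ x in D, (g x) ^ 2 ∂sphereMeasure n)}

/-- The energy functional `J^σ(u) = (1/p)∫|∇u|^p - (1/q)∫ |x|^{(σ-1)q}|u|^q`. -/
def Jfun {n : ℕ} (Ω : Set (Euc n)) (p σ q : ℝ) (u : Euc n → ℝ) (g : Euc n → Euc n) : ℝ :=
  (1 / p) * (∫ x in Ω, ‖g x‖ ^ p) - (1 / q) * ∫ x in Ω, ‖x‖ ^ ((σ - 1) * q) * |u x| ^ q

/-- Membership in the Nehari manifold `𝒩^σ(Ω)`. -/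
def Nehari {n : ℕ} (Ω : Set (Euc n)) (p σ q : ℝ) (u : Euc n → ℝ) (g : Euc n → Euc n) : Prop :=
  wNorm Ω σ q u ≠ 0 ∧
    (∫ x in Ω, ‖g x‖ ^ p) = ∫ x in Ω, ‖x‖ ^ ((σ - 1) * q) * |u x| ^ q

/-- The one-point compactification `Σ̄_D` of the closed cone over `D`. -/
def ConeComp (n : ℕ) (D : Set (Euc n)) : Type := OnePoint ↥(closure (cone D))

instance (n : ℕ) (D : Set (Euc n)) : TopologicalSpace (ConeComp n D) :=
  inferInstanceAs (TopologicalSpace (OnePoint ↥(closure (cone D))))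

instance (n : ℕ) (D : Set (Euc n)) : MeasurableSpace (ConeComp n D) :=
  borel (ConeComp n D)

instance (n : ℕ) (D : Set (Euc n)) : BorelSpace (ConeComp n D) := ⟨rfl⟩

/-- The canonical map from `ℝ^n` to the compactified cone `Σ̄_D` (points outside the
closed cone are sent to `∞`; only its restriction to the cone is ever used). -/
def conePt {n : ℕ} (D : Set (Euc n)) (x : Euc n) : ConeComp n D :=
  if h : x ∈ closure (cone D) then (OnePoint.some ⟨x, h⟩ : OnePoint ↥(closure (cone D)))
  else OnePoint.infty

/-- The point `∞` of the compactified cone. -/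
def coneInfty (n : ℕ) (D : Set (Euc n)) : ConeComp n D :=
  (OnePoint.infty : OnePoint ↥(closure (cone D)))

/-! ### Polar coordinates -/

lemma sphereMeasure_eq_map_toSphere (n : ℕ) :
    sphereMeasure n = (volume : Measure (Euc n)).toSphere.map Subtype.val := by
  have hm : Measurable (fun x : Euc n => ‖x‖⁻¹ • x) := by fun_prop
  ext s hs
  have hs' : MeasurableSet ((Subtype.val : Metric.sphere (0 : Euc n) 1 → Euc n) ⁻¹' s) :=
    measurable_subtype_coe hs
  rw [Measure.map_apply measurable_subtype_coe hs, Measure.toSphere_apply' _ hs', sphereMeasure,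
    Measure.smul_apply, Measure.map_apply hm hs, Measure.restrict_apply (hm hs)]
  simp only [finrank_euclideanSpace, Fintype.card_fin, smul_eq_mul]
  congr 2
  ext x
  simp only [mem_inter_iff, mem_preimage, Set.mem_sdiff, Metric.mem_ball, dist_zero_right,
    mem_singleton_iff, Subtype.image_preimage_coe, Set.mem_smul, mem_Ioo]
  constructor
  · rintro ⟨hxs, hx1, hx0⟩
    have hpos : 0 < ‖x‖ := norm_pos_iff.2 hx0
    refine ⟨‖x‖, ⟨hpos, hx1⟩, ‖x‖⁻¹ • x, ⟨?_, hxs⟩, ?_⟩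
    · simp [norm_smul, hpos.ne']
    · rw [smul_inv_smul₀ hpos.ne']
  · rintro ⟨r, ⟨hr0, hr1⟩, y, ⟨hy, hys⟩, rfl⟩
    have hy1 : ‖y‖ = 1 := by simpa using hy
    have hn : ‖r • y‖ = r := by rw [norm_smul, hy1, mul_one, Real.norm_of_nonneg hr0.le]
    refine ⟨?_, ?_, ?_⟩
    · rwa [hn, inv_smul_smul₀ hr0.ne']
    · rwa [hn]
    · exact norm_ne_zero_iff.1 (by rw [hn]; exact hr0.ne')

instance (n : ℕ) : IsFiniteMeasure (sphereMeasure n) := by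
  rw [sphereMeasure_eq_map_toSphere]; infer_instance

lemma integrable_volumeIoiPow_iff (m : ℕ) (φ : ℝ → ℝ) :
    Integrable (fun r : Ioi (0 : ℝ) => φ r) (Measure.volumeIoiPow m) ↔
      IntegrableOn (fun r => r ^ m * φ r) (Ioi 0) := by
  rw [integrableOn_iff_comap_subtypeVal measurableSet_Ioi, Function.comp_def,
    Measure.volumeIoiPow, integrable_withDensity_iff_integrable_smul', integrable_congr]
  · refine .of_forall ?_
    rintro ⟨x, hx : 0 < x⟩
    simp (disch := positivity) [ENNReal.toReal_ofReal]
  · fun_prop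
  · simp

lemma integral_volumeIoiPow (m : ℕ) (φ : ℝ → ℝ) :
    ∫ r : Ioi (0 : ℝ), φ r ∂Measure.volumeIoiPow m = ∫ r in Ioi (0 : ℝ), r ^ m * φ r := by
  simp only [Measure.volumeIoiPow, ENNReal.ofReal]
  rw [integral_withDensity_eq_integral_smul,
    integral_subtype_comap measurableSet_Ioi fun a ↦ Real.toNNReal (a ^ m) • φ a,
    setIntegral_congr_fun measurableSet_Ioi fun x hx ↦ ?_]
  · rw [NNReal.smul_def, Real.coe_toNNReal _ (pow_nonneg (le_of_lt hx) _), smul_eq_mul]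
  · exact (measurable_subtype_coe.pow_const _).real_toNNReal

lemma mem_cone_iff {n : ℕ} {D : Set (Euc n)} (hD : D ⊆ unitSphere n) (x : Euc n) :
    x ∈ cone D ↔ x ≠ 0 ∧ ‖x‖⁻¹ • x ∈ D := by
  constructor
  · rintro ⟨y, hy, t, ht, rfl⟩
    have hy1 : ‖y‖ = 1 := by simpa [unitSphere] using hD hy
    have hn : ‖t • y‖ = t := by rw [norm_smul, hy1, mul_one, Real.norm_of_nonneg ht.le]
    refine ⟨?_, ?_⟩
    · rw [← norm_ne_zero_iff, hn]; exact ht.ne'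
    · rwa [hn, inv_smul_smul₀ ht.ne']
  · rintro ⟨h0, hx⟩
    exact ⟨_, hx, ‖x‖, norm_pos_iff.2 h0, by rw [smul_inv_smul₀ (norm_ne_zero_iff.2 h0)]⟩

lemma measurableSet_of_isOpenInSphere {n : ℕ} {D : Set (Euc n)} (hD : IsOpenInSphere D) :
    MeasurableSet D := by
  obtain ⟨-, V, hV, rfl⟩ := hD
  exact hV.measurableSet.inter Metric.isClosed_sphere.measurableSet

lemma measurableSet_cone {n : ℕ} {D : Set (Euc n)} (hD : IsOpenInSphere D) :
    MeasurableSet (cone D) := by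
  have h : cone D = {0}ᶜ ∩ (fun x : Euc n => ‖x‖⁻¹ • x) ⁻¹' D := by
    ext x
    rw [mem_cone_iff hD.1]
    rfl
  have hm : Measurable (fun x : Euc n => ‖x‖⁻¹ • x) := by fun_prop
  rw [h]
  exact (measurableSet_singleton _).compl.inter (hm (measurableSet_of_isOpenInSphere hD))

/-- Integration in polar coordinates of a product of a radial and an angular function. -/
lemma integrableOn_cone_and_integral {n : ℕ} (hn : 1 ≤ n) {D : Set (Euc n)}
    (hD : IsOpenInSphere D) {φ : ℝ → ℝ} {G : Euc n → ℝ}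
    (hφ : IntegrableOn (fun r => r ^ ((n : ℝ) - 1) * φ r) (Ioi 0))
    (hG : IntegrableOn G D (sphereMeasure n)) :
    IntegrableOn (fun x => φ ‖x‖ * G (‖x‖⁻¹ • x)) (cone D) ∧
      ∫ x in cone D, φ ‖x‖ * G (‖x‖⁻¹ • x) =
        (∫ r in Ioi (0 : ℝ), r ^ ((n : ℝ) - 1) * φ r) * ∫ x in D, G x ∂sphereMeasure n := by
  have hDm := measurableSet_of_isOpenInSphere hD
  have : NeZero n := ⟨by omega⟩
  have hpow : (fun r : ℝ => r ^ ((n : ℝ) - 1) * φ r) = fun r => r ^ (n - 1) * φ r := by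
    funext r
    rw [← Nat.cast_one, ← Nat.cast_sub hn, Real.rpow_natCast]
  have hemb : MeasurableEmbedding (Subtype.val : Metric.sphere (0 : Euc n) 1 → Euc n) :=
    MeasurableEmbedding.subtype_coe Metric.isClosed_sphere.measurableSet
  rw [hpow] at hφ ⊢
  rw [← integrable_volumeIoiPow_iff] at hφ
  rw [← integral_volumeIoiPow]
  rw [← integrable_indicator_iff hDm, sphereMeasure_eq_map_toSphere, hemb.integrable_map_iff] at hG
  rw [← integral_indicator hDm, sphereMeasure_eq_map_toSphere, hemb.integral_map]
  rw [← integrable_indicator_iff (measurableSet_cone hD),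
    ← integral_indicator (measurableSet_cone hD)]
  set F : Euc n → ℝ := (cone D).indicator fun x => φ ‖x‖ * G (‖x‖⁻¹ • x) with hF
  have hmp := (volume : Measure (Euc n)).measurePreserving_homeomorphUnitSphereProd
  rw [finrank_euclideanSpace, Fintype.card_fin] at hmp
  have hcomp : ∀ x : ({0}ᶜ : Set (Euc n)), F x =
      (fun z : Metric.sphere (0 : Euc n) 1 × Ioi (0 : ℝ) => D.indicator G z.1 * φ z.2)
        (homeomorphUnitSphereProd (Euc n) x) := by
    rintro ⟨x, hx⟩
    simp only [hF, homeomorphUnitSphereProd_apply_fst_coe, homeomorphUnitSphereProd_apply_snd_coe]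
    by_cases h : ‖x‖⁻¹ • x ∈ D
    · rw [indicator_of_mem ((mem_cone_iff hD.1 x).2 ⟨hx, h⟩), indicator_of_mem h, mul_comm]
    · rw [indicator_of_notMem (fun h' => h ((mem_cone_iff hD.1 x).1 h').2), indicator_of_notMem h,
        zero_mul]
  have hres : (volume : Measure (Euc n)).restrict {0}ᶜ = volume :=
    restrict_compl_singleton 0
  constructor
  · rw [← hres, ← IntegrableOn,
      integrableOn_iff_comap_subtypeVal (measurableSet_singleton _).compl, Function.comp_def]
    simp_rw [hcomp]
    exact (hmp.integrable_comp_emb (Homeomorph.measurableEmbedding _)).2 (hG.mul_prod hφ)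
  · have hint : ∫ x, F x = ∫ x in ({0}ᶜ : Set (Euc n)), F x := by rw [hres]
    rw [hint, ← integral_subtype_comap (measurableSet_singleton _).compl]
    simp_rw [hcomp]
    rw [hmp.integral_comp (Homeomorph.measurableEmbedding _)
      (fun z : Metric.sphere (0 : Euc n) 1 × Ioi (0 : ℝ) => D.indicator G z.1 * φ z.2),
      integral_prod_mul (fun y : Metric.sphere (0 : Euc n) 1 => D.indicator G y)
        (fun r : Ioi (0 : ℝ) => φ r), mul_comm]

lemma integrableOn_sphereMeasure {n : ℕ} {D : Set (Euc n)} (hD : IsOpenInSphere D)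
    {G : Euc n → ℝ} (hG : ContinuousOn G {(0 : Euc n)}ᶜ) :
    IntegrableOn G D (sphereMeasure n) := by
  refine ((hG.mono ?_).integrableOn_compact (isCompact_sphere (0 : Euc n) 1)).mono_set hD.1
  rintro x hx rfl
  simp at hx

lemma setIntegral_sphereMeasure_pos {n : ℕ} {D : Set (Euc n)} (hD : IsOpenInSphere D)
    {G : Euc n → ℝ} (hG : ContinuousOn G {(0 : Euc n)}ᶜ) (hG0 : ∀ x, 0 ≤ G x)
    (hne : ∃ x ∈ D, G x ≠ 0) : 0 < ∫ x in D, G x ∂sphereMeasure n := by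
  rw [setIntegral_pos_iff_support_of_nonneg_ae (.of_forall hG0) (integrableOn_sphereMeasure hD hG)]
  obtain ⟨x, hxD, hx⟩ := hne
  have hDm := measurableSet_of_isOpenInSphere hD
  obtain ⟨hDs, V, hV, hDV⟩ := hD
  have hO : IsOpen ({(0 : Euc n)}ᶜ ∩ G ⁻¹' {0}ᶜ) :=
    hG.isOpen_inter_preimage isOpen_compl_singleton isOpen_compl_singleton
  have hxs : x ∈ Metric.sphere (0 : Euc n) 1 := hDs hxD
  have hsub : V ∩ ({(0 : Euc n)}ᶜ ∩ G ⁻¹' {0}ᶜ) ∩ Metric.sphere 0 1 ⊆ Function.support G ∩ D := by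
    rintro y ⟨⟨hyV, -, hyG⟩, hys⟩
    exact ⟨hyG, by rw [hDV]; exact ⟨hyV, hys⟩⟩
  have hO' := hV.inter hO
  refine lt_of_lt_of_le ?_ (measure_mono hsub)
  rw [sphereMeasure_eq_map_toSphere, Measure.map_apply measurable_subtype_coe
    (hO'.measurableSet.inter Metric.isClosed_sphere.measurableSet)]
  have hopen : IsOpen ((Subtype.val : Metric.sphere (0 : Euc n) 1 → Euc n) ⁻¹'
      (V ∩ ({(0 : Euc n)}ᶜ ∩ G ⁻¹' {0}ᶜ))) := hO'.preimage continuous_subtype_val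
  rw [preimage_inter, Subtype.coe_preimage_self, inter_univ]
  refine hopen.measure_pos _ ⟨⟨x, hxs⟩, ?_, ?_, hx⟩
  · rw [hDV] at hxD; exact hxD.1
  · rintro rfl; simp at hxs

/-! ### Homogeneity of the gradient -/

lemma norm_gradient_of_isZeroHomog {n : ℕ} {g : Euc n → ℝ} (hg : IsZeroHomog g) {x : Euc n}
    (hx : x ≠ 0) : ‖gradient g x‖ = ‖x‖⁻¹ * ‖gradient g (‖x‖⁻¹ • x)‖ := by
  have ht : 0 < ‖x‖⁻¹ := inv_pos.2 (norm_pos_iff.2 hx)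
  have h : (fun y => g (‖x‖⁻¹ • y)) =ᶠ[𝓝 x] g := by
    filter_upwards [isOpen_compl_singleton.mem_nhds hx] with y hy
    exact hg _ ht y hy
  simp only [gradient, LinearIsometryEquiv.norm_map]
  rw [← h.fderiv_eq, fderiv_comp_smul, norm_smul, Real.norm_of_nonneg ht.le]

lemma continuousOn_norm_gradient {n : ℕ} {g : Euc n → ℝ} (hg : ContDiffOn ℝ 1 g {(0 : Euc n)}ᶜ) :
    ContinuousOn (fun x => ‖gradient g x‖) {(0 : Euc n)}ᶜ := by
  simp only [gradient, LinearIsometryEquiv.norm_map]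
  exact (hg.continuousOn_fderiv_of_isOpen isOpen_compl_singleton le_rfl).norm

/-! ### Radial profiles -/

lemma profile_le_rpow {κ s t r : ℝ} (hr : 0 < r) (ht : 0 ≤ t) :
    r ^ s * (1 + r ^ κ) ^ (-t) ≤ r ^ s := by
  have hκ := Real.rpow_pos_of_pos hr κ
  exact mul_le_of_le_one_right (Real.rpow_pos_of_pos hr s).le
    (Real.rpow_le_one_of_one_le_of_nonpos (by linarith) (by linarith))

lemma profile_le_rpow_sub {κ s t r : ℝ} (hr : 0 < r) (ht : 0 ≤ t) :
    r ^ s * (1 + r ^ κ) ^ (-t) ≤ r ^ (s - κ * t) := by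
  have hκ := Real.rpow_pos_of_pos hr κ
  have h : (1 + r ^ κ) ^ (-t) ≤ (r ^ κ) ^ (-t) :=
    Real.rpow_le_rpow_of_nonpos hκ (by linarith) (by linarith)
  calc r ^ s * (1 + r ^ κ) ^ (-t) ≤ r ^ s * (r ^ κ) ^ (-t) := by gcongr
    _ = r ^ (s - κ * t) := by
      rw [← Real.rpow_mul hr.le, ← Real.rpow_add hr]; congr 1; ring

lemma profile_pos {κ s t r : ℝ} (hr : 0 < r) : 0 < r ^ s * (1 + r ^ κ) ^ (-t) := by
  have hκ := Real.rpow_pos_of_pos hr κ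
  positivity

lemma integrableOn_profile {κ s t : ℝ} (ht : 0 ≤ t) (hs : -1 < s) (hst : s - κ * t < -1) :
    IntegrableOn (fun r : ℝ => r ^ s * (1 + r ^ κ) ^ (-t)) (Ioi 0) := by
  have hm : Measurable (fun r : ℝ => r ^ s * (1 + r ^ κ) ^ (-t)) := by fun_prop
  rw [← Ioc_union_Ioi_eq_Ioi zero_le_one]
  refine IntegrableOn.union ?_ ?_
  · have h : IntegrableOn (fun r : ℝ => r ^ s) (Ioc 0 1) :=
      (intervalIntegrable_iff_integrableOn_Ioc_of_le zero_le_one).1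
        (intervalIntegral.intervalIntegrable_rpow' hs)
    refine h.mono' hm.aestronglyMeasurable ?_
    filter_upwards [ae_restrict_mem measurableSet_Ioc] with r hr
    rw [Real.norm_of_nonneg (profile_pos hr.1).le]
    exact profile_le_rpow hr.1 ht
  · refine (integrableOn_Ioi_rpow_of_lt hst zero_lt_one).mono' hm.aestronglyMeasurable ?_
    filter_upwards [ae_restrict_mem measurableSet_Ioi] with r hr
    have hr0 : 0 < r := zero_lt_one.trans hr
    rw [Real.norm_of_nonneg (profile_pos hr0).le]
    exact profile_le_rpow_sub hr0 ht

lemma tendsto_profile_nhdsGT_zero {κ s t : ℝ} (ht : 0 ≤ t) (hs : 0 < s) :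
    Tendsto (fun r : ℝ => r ^ s * (1 + r ^ κ) ^ (-t)) (𝓝[>] 0) (𝓝 0) := by
  have h : Tendsto (fun r : ℝ => r ^ s) (𝓝[>] 0) (𝓝 0) := by
    have := (Real.continuousAt_rpow_const 0 s (Or.inr hs.le)).tendsto
    rw [Real.zero_rpow hs.ne'] at this
    exact this.mono_left nhdsWithin_le_nhds
  refine squeeze_zero' ?_ ?_ h
  · filter_upwards [self_mem_nhdsWithin] with r hr using (profile_pos hr).le
  · filter_upwards [self_mem_nhdsWithin] with r hr using profile_le_rpow hr ht

lemma tendsto_profile_atTop {κ s t : ℝ} (ht : 0 ≤ t) (hs : s - κ * t < 0) :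
    Tendsto (fun r : ℝ => r ^ s * (1 + r ^ κ) ^ (-t)) atTop (𝓝 0) := by
  have h := tendsto_rpow_neg_atTop (y := -(s - κ * t)) (by linarith)
  rw [neg_neg] at h
  refine squeeze_zero' ?_ ?_ h
  · filter_upwards [Ioi_mem_atTop 0] with r hr using (profile_pos hr).le
  · filter_upwards [Ioi_mem_atTop 0] with r hr using profile_le_rpow_sub hr ht

lemma hasDerivAt_profile {κ s t r : ℝ} (hr : 0 < r) :
    HasDerivAt (fun x : ℝ => x ^ s * (1 + x ^ κ) ^ (-t))
      (s * r ^ (s - 1) * (1 + r ^ κ) ^ (-t) +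
        r ^ s * (κ * r ^ (κ - 1) * (-t) * (1 + r ^ κ) ^ (-t - 1))) r := by
  have hκ := Real.rpow_pos_of_pos hr κ
  have h1 := Real.hasDerivAt_rpow_const (p := s) (Or.inl hr.ne')
  have h2 := ((Real.hasDerivAt_rpow_const (p := κ) (Or.inl hr.ne')).const_add 1).rpow_const
    (p := -t) (Or.inl (by positivity))
  exact h1.mul h2

lemma abs_deriv_profile_le {κ s t r : ℝ} (hκ : 0 ≤ κ) (ht : 0 ≤ t) (hr : 0 < r) :
    |s * r ^ (s - 1) * (1 + r ^ κ) ^ (-t) +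
        r ^ s * (κ * r ^ (κ - 1) * (-t) * (1 + r ^ κ) ^ (-t - 1))| ≤
      (|s| + κ * t) * (r ^ (s - 1) * (1 + r ^ κ) ^ (-t)) := by
  have hκr := Real.rpow_pos_of_pos hr κ
  have hW : 0 < 1 + r ^ κ := by linarith
  have h1 : r ^ s = r ^ (s - 1) * r := by rw [Real.rpow_sub_one hr.ne']; field_simp
  have h2 : r ^ (κ - 1) = r ^ κ / r := Real.rpow_sub_one hr.ne' κ
  have h3 : (1 + r ^ κ) ^ (-t - 1) = (1 + r ^ κ) ^ (-t) / (1 + r ^ κ) :=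
    Real.rpow_sub_one hW.ne' _
  have hpos : 0 < r ^ (s - 1) * (1 + r ^ κ) ^ (-t) := profile_pos hr
  have hq0 : 0 ≤ r ^ κ / (1 + r ^ κ) := by positivity
  have hq1 : r ^ κ / (1 + r ^ κ) ≤ 1 := by rw [div_le_one hW]; linarith
  have hkt : 0 ≤ κ * t := mul_nonneg hκ ht
  have e : s * r ^ (s - 1) * (1 + r ^ κ) ^ (-t) +
      r ^ s * (κ * r ^ (κ - 1) * (-t) * (1 + r ^ κ) ^ (-t - 1)) =
      (s - κ * t * (r ^ κ / (1 + r ^ κ))) * (r ^ (s - 1) * (1 + r ^ κ) ^ (-t)) := by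
    rw [h1, h2, h3]; field_simp; ring
  rw [e, abs_mul, abs_of_pos hpos]
  gcongr
  refine (abs_sub _ _).trans ?_
  rw [abs_of_nonneg (mul_nonneg hkt hq0)]
  exact add_le_add_right (mul_le_of_le_one_right hkt hq1) _

/-! ### The linearized radial equation -/

section Radial

variable {d p σ q α : ℝ} {U f : ℝ → ℝ}

lemma hasDerivAt_flux (hU3 : ContDiffOn ℝ 3 U (Ioi 0)) (hU' : ∀ r ∈ Ioi (0 : ℝ), deriv U r < 0)
    (hODE : ∀ r ∈ Ioi (0 : ℝ),
      deriv (fun s => s ^ (d - 1) * |deriv U s| ^ (p - 2) * deriv U s) r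
        = -(r ^ (d - 1 + (σ - 1) * q) * (U r) ^ (q - 1)))
    (hf : f = fun r => r ^ α * deriv U r) (hαp : α * p = (1 - σ) * q) {r : ℝ} (hr : 0 < r) :
    HasDerivAt (fun s => s ^ (d - 1) * |deriv U s| ^ (p - 2) * deriv U s)
        (-(r ^ (d - 1 + (σ - 1) * q) * (U r) ^ (q - 1))) r ∧
      HasDerivAt f (deriv f r) r ∧
      (p - 1) * (r ^ (d - 1) * |deriv U r| ^ (p - 2)) * deriv f r =
        -(r ^ (d - 1 - α * (p - 1)) * (U r) ^ (q - 1)) - (d - 1 - α * (p - 1)) *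
          (r ^ (α - 1) * (r ^ (d - 1) * |deriv U r| ^ (p - 2) * deriv U r)) := by
  have hO : Ioi (0 : ℝ) ∈ 𝓝 r := Ioi_mem_nhds hr
  have h2 : HasDerivAt (deriv U) (deriv (deriv U) r) r := by
    have : ContDiffOn ℝ 1 (deriv U) (Ioi 0) :=
      hU3.deriv_of_isOpen isOpen_Ioi (by norm_num)
    exact ((this.differentiableOn (by norm_num)).differentiableAt hO).hasDerivAt
  have hy : 0 < -deriv U r := by linarith [hU' r hr]
  have hV : HasDerivAt (fun s => s ^ (d - 1) * |deriv U s| ^ (p - 2) * deriv U s)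
      (-((d - 1) * r ^ (d - 1 - 1) * (-deriv U r) ^ (p - 1) + r ^ (d - 1) *
        (-deriv (deriv U) r * (p - 1) * (-deriv U r) ^ (p - 1 - 1)))) r := by
    refine ((Real.hasDerivAt_rpow_const (Or.inl hr.ne')).mul
      (h2.neg.rpow_const (Or.inl hy.ne'))).neg.congr_of_eventuallyEq ?_
    filter_upwards [hO] with s hs
    have hs' : 0 < -deriv U s := by linarith [hU' s hs]
    simp only [Pi.neg_apply, Pi.mul_apply]
    rw [abs_of_neg (hU' s hs), show p - 1 = p - 2 + 1 by ring, Real.rpow_add_one hs'.ne']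
    ring
  have hVeq := (hODE r hr).symm.trans hV.deriv
  have hf1 : HasDerivAt f (α * r ^ (α - 1) * deriv U r + r ^ α * deriv (deriv U) r) r := by
    rw [hf]; exact (Real.hasDerivAt_rpow_const (Or.inl hr.ne')).mul h2
  refine ⟨hVeq ▸ hV, hf1.deriv ▸ hf1, ?_⟩
  have hk : r ^ (d - 1 - α * (p - 1)) = r ^ α * r ^ (d - 1 + (σ - 1) * q) := by
    rw [← Real.rpow_add hr]; congr 1; linarith
  have e1 : -(r ^ (d - 1 - α * (p - 1)) * (U r) ^ (q - 1)) =
      r ^ α * (-(r ^ (d - 1 + (σ - 1) * q) * (U r) ^ (q - 1))) := by rw [hk]; ring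
  rw [e1, hVeq, hf1.deriv, abs_of_neg (hU' r hr), show p - 1 - 1 = p - 2 by ring,
    show (-deriv U r) ^ (p - 1) = (-deriv U r) ^ (p - 2) * (-deriv U r) by
      rw [← Real.rpow_add_one hy.ne']; congr 1; ring,
    Real.rpow_sub_one hr.ne' (d - 1), Real.rpow_sub_one hr.ne' α]
  field_simp
  ring

lemma hasDerivAt_flux_mul (hU3 : ContDiffOn ℝ 3 U (Ioi 0)) (hUpos : ∀ r ∈ Ioi (0 : ℝ), 0 < U r)
    (hU' : ∀ r ∈ Ioi (0 : ℝ), deriv U r < 0)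
    (hODE : ∀ r ∈ Ioi (0 : ℝ),
      deriv (fun s => s ^ (d - 1) * |deriv U s| ^ (p - 2) * deriv U s) r
        = -(r ^ (d - 1 + (σ - 1) * q) * (U r) ^ (q - 1)))
    (hf : f = fun r => r ^ α * deriv U r) (hαp : α * p = (1 - σ) * q) {r : ℝ} (hr : 0 < r) :
    HasDerivAt (fun s => (p - 1) * (s ^ (d - 1) * |deriv U s| ^ (p - 2)) * deriv f s * f s)
      (r ^ (d - 1) * (|deriv U r| ^ (p - 2) * ((p - 1) * deriv f r ^ 2))
        - (q - 1) * (r ^ (d - 1) * (r ^ ((σ - 1) * q) * U r ^ (q - 2) * f r ^ 2))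
        + (1 - α) * (d - 1 - α * (p - 1)) *
          (r ^ (d - 1) * (|deriv U r| ^ (p - 2) * (f r ^ 2 / r ^ 2)))) r := by
  have hO : Ioi (0 : ℝ) ∈ 𝓝 r := Ioi_mem_nhds hr
  obtain ⟨hV, hf', hP⟩ := hasDerivAt_flux hU3 hU' hODE hf hαp hr
  have hU1 : HasDerivAt U (deriv U r) r :=
    ((hU3.differentiableOn (by norm_num)).differentiableAt hO).hasDerivAt
  have hk := Real.hasDerivAt_rpow_const (p := d - 1 - α * (p - 1)) (Or.inl hr.ne')
  have hα1 := Real.hasDerivAt_rpow_const (p := α - 1) (Or.inl hr.ne')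
  have hUq := hU1.rpow_const (p := q - 1) (Or.inl (hUpos r hr).ne')
  have hQ := (((hk.mul hUq).neg.sub ((hα1.mul hV).const_mul (d - 1 - α * (p - 1)))).mul hf')
  refine HasDerivAt.congr_of_eventuallyEq (hQ.congr_deriv ?_) ?_
  swap
  · filter_upwards [hO] with s hs
    rw [(hasDerivAt_flux hU3 hU' hODE hf hαp hs).2.2]
    rfl
  simp only [Pi.neg_apply, Pi.mul_apply, Pi.sub_apply]
  rw [← hP]
  have r1 : r ^ (d - 1 - α * (p - 1)) = r ^ (d - 1) * r ^ ((σ - 1) * q) * r ^ α := by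
    rw [← Real.rpow_add hr, ← Real.rpow_add hr]; congr 1; linarith
  rw [show q - 1 - 1 = q - 2 by ring, Real.rpow_sub_one hr.ne' (d - 1 - α * (p - 1)), r1,
    Real.rpow_sub_one hr.ne' (α - 1), Real.rpow_sub_one hr.ne' α, Real.rpow_add hr (d - 1)]
  have hfr : f r = r ^ α * deriv U r := by rw [hf]
  rw [hfr]
  field_simp
  ring

end Radial

section RadialIntegrals

variable {d p σ q α κ β C : ℝ} {U f : ℝ → ℝ}

lemma deriv_radial (hU : ∀ r ∈ Ioi (0 : ℝ), U r = C * (1 + r ^ κ) ^ (-β)) {r : ℝ} (hr : 0 < r) :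
    deriv U r = -(C * β * κ * (r ^ (κ - 1) * (1 + r ^ κ) ^ (-(β + 1)))) := by
  have hκ := Real.rpow_pos_of_pos hr κ
  have h := ((((Real.hasDerivAt_rpow_const (p := κ) (Or.inl hr.ne')).const_add 1).rpow_const
    (p := -β) (Or.inl (by positivity))).const_mul C)
  have hEq : U =ᶠ[𝓝 r] fun r => C * (1 + r ^ κ) ^ (-β) := by
    filter_upwards [Ioi_mem_nhds hr] with s hs using hU s hs
  rw [hEq.deriv_eq, h.deriv, show -(β + 1) = -β - 1 by ring]
  ring

lemma direction_eq (hU : ∀ r ∈ Ioi (0 : ℝ), U r = C * (1 + r ^ κ) ^ (-β))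
    (hf : f = fun r => r ^ α * deriv U r) {r : ℝ} (hr : 0 < r) :
    f r = -(C * β * κ * (r ^ (κ - 1 + α) * (1 + r ^ κ) ^ (-(β + 1)))) := by
  rw [hf, Real.rpow_add hr]
  simp only [deriv_radial hU hr]
  ring

lemma abs_deriv_direction_le (hκ : 0 < κ) (hβ : 0 < β) (hC : 0 < C)
    (hU : ∀ r ∈ Ioi (0 : ℝ), U r = C * (1 + r ^ κ) ^ (-β))
    (hf : f = fun r => r ^ α * deriv U r) {r : ℝ} (hr : 0 < r) :
    |deriv f r| ≤ C * β * κ * (|κ - 1 + α| + κ * (β + 1)) *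
      (r ^ (κ - 1 + α - 1) * (1 + r ^ κ) ^ (-(β + 1))) := by
  have hEq : f =ᶠ[𝓝 r] fun r => -(C * β * κ * (r ^ (κ - 1 + α) * (1 + r ^ κ) ^ (-(β + 1)))) := by
    filter_upwards [Ioi_mem_nhds hr] with s hs using direction_eq hU hf hs
  have hder := ((hasDerivAt_profile (κ := κ) (s := κ - 1 + α) (t := β + 1) hr).const_mul
    (C * β * κ)).fun_neg
  rw [hEq.deriv_eq, hder.deriv, abs_neg, abs_mul,
    abs_of_pos (by positivity : 0 < C * β * κ), mul_assoc (C * β * κ)]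
  exact mul_le_mul_of_nonneg_left (abs_deriv_profile_le hκ.le (by positivity) hr) (by positivity)

lemma weight_mul_sq (hκ : 0 < κ) (hβ : 0 < β) (hC : 0 < C)
    (hU : ∀ r ∈ Ioi (0 : ℝ), U r = C * (1 + r ^ κ) ^ (-β)) {r : ℝ} (hr : 0 < r) :
    r ^ (d - 1) * |deriv U r| ^ (p - 2) *
        (r ^ (κ - 1 + α - 1) * (1 + r ^ κ) ^ (-(β + 1))) ^ 2 =
      (C * β * κ) ^ (p - 2) *
        (r ^ (d - 3 + (κ - 1) * p + 2 * α) * (1 + r ^ κ) ^ (-((β + 1) * p))) := by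
  have hκr := Real.rpow_pos_of_pos hr κ
  have hW : 0 < 1 + r ^ κ := by linarith
  have hpr : 0 < r ^ (κ - 1) * (1 + r ^ κ) ^ (-(β + 1)) := profile_pos hr
  have e1 : r ^ (d - 3 + (κ - 1) * p + 2 * α) =
      r ^ (d - 1) * r ^ ((κ - 1) * (p - 2)) * (r ^ (κ - 1 + α - 1) * r ^ (κ - 1 + α - 1)) := by
    simp only [← Real.rpow_add hr]; congr 1; ring
  have e2 : (1 + r ^ κ) ^ (-((β + 1) * p)) = (1 + r ^ κ) ^ (-(β + 1) * (p - 2)) *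
      ((1 + r ^ κ) ^ (-(β + 1)) * (1 + r ^ κ) ^ (-(β + 1))) := by
    simp only [← Real.rpow_add hW]; congr 1; ring
  rw [deriv_radial hU hr, abs_neg, abs_of_pos (by positivity),
    Real.mul_rpow (by positivity) hpr.le,
    Real.mul_rpow (Real.rpow_nonneg hr.le _) (Real.rpow_nonneg hW.le _),
    ← Real.rpow_mul hr.le, ← Real.rpow_mul hW.le, e1, e2]
  ring

lemma potential_mul_sq (hC : 0 < C)
    (hU : ∀ r ∈ Ioi (0 : ℝ), U r = C * (1 + r ^ κ) ^ (-β))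
    (hf : f = fun r => r ^ α * deriv U r) {r : ℝ} (hr : 0 < r) :
    r ^ (d - 1) * (r ^ ((σ - 1) * q) * U r ^ (q - 2) * f r ^ 2) =
      C ^ (q - 2) * (C * β * κ) ^ 2 *
        (r ^ (d - 1 + (σ - 1) * q + 2 * (κ - 1 + α)) * (1 + r ^ κ) ^ (-(β * q + 2))) := by
  have hκr := Real.rpow_pos_of_pos hr κ
  have hW : 0 < 1 + r ^ κ := by linarith
  have e1 : r ^ (d - 1 + (σ - 1) * q + 2 * (κ - 1 + α)) =
      r ^ (d - 1) * r ^ ((σ - 1) * q) * (r ^ (κ - 1 + α) * r ^ (κ - 1 + α)) := by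
    simp only [← Real.rpow_add hr]; congr 1; ring
  have e2 : (1 + r ^ κ) ^ (-(β * q + 2)) = (1 + r ^ κ) ^ (-β * (q - 2)) *
      ((1 + r ^ κ) ^ (-(β + 1)) * (1 + r ^ κ) ^ (-(β + 1))) := by
    simp only [← Real.rpow_add hW]; congr 1; ring
  rw [direction_eq hU hf hr, hU r hr, Real.mul_rpow hC.le (Real.rpow_nonneg hW.le _),
    ← Real.rpow_mul hW.le, e1, e2]
  ring

/-- The radial part of the second variation is a negative multiple of the Hardy-type weight
integral of `f ^ 2 / r ^ 2`. -/
lemma radial_second_variation (hp : 1 < p) (hpd : p < d) (hd : 2 ≤ d) (hα0 : 0 ≤ α) (hα1 : α < 1)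
    (hq : 0 < q) (hαp : α * p = (1 - σ) * q) (hqd : (d - p) * q = p * (d - α * p))
    (hκ : 0 < κ) (hκp : κ * (p - 1) = p * (1 - α)) (hβ : 0 < β)
    (hβp : κ * β * (p - 1) = d - p) (hC : 0 < C)
    (hU : ∀ r ∈ Ioi (0 : ℝ), U r = C * (1 + r ^ κ) ^ (-β))
    (hU3 : ContDiffOn ℝ 3 U (Ioi 0)) (hUpos : ∀ r ∈ Ioi (0 : ℝ), 0 < U r)
    (hU' : ∀ r ∈ Ioi (0 : ℝ), deriv U r < 0)
    (hODE : ∀ r ∈ Ioi (0 : ℝ),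
      deriv (fun s => s ^ (d - 1) * |deriv U s| ^ (p - 2) * deriv U s) r
        = -(r ^ (d - 1 + (σ - 1) * q) * (U r) ^ (q - 1)))
    (hf : f = fun r => r ^ α * deriv U r) :
    IntegrableOn (fun r => r ^ (d - 1) * (|deriv U r| ^ (p - 2) * (f r ^ 2 / r ^ 2))) (Ioi 0) ∧
    (0 < ∫ r in Ioi (0 : ℝ), r ^ (d - 1) * (|deriv U r| ^ (p - 2) * (f r ^ 2 / r ^ 2))) ∧
    IntegrableOn (fun r => r ^ (d - 1) * (|deriv U r| ^ (p - 2) * ((p - 1) * deriv f r ^ 2)))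
      (Ioi 0) ∧
    IntegrableOn (fun r => r ^ (d - 1) * (r ^ ((σ - 1) * q) * U r ^ (q - 2) * f r ^ 2)) (Ioi 0) ∧
    (∫ r in Ioi (0 : ℝ), r ^ (d - 1) * (|deriv U r| ^ (p - 2) * ((p - 1) * deriv f r ^ 2)))
      - (q - 1) * (∫ r in Ioi (0 : ℝ), r ^ (d - 1) * (r ^ ((σ - 1) * q) * U r ^ (q - 2) * f r ^ 2))
      = -((1 - α) * (d - 1 - α * (p - 1)) *
        ∫ r in Ioi (0 : ℝ), r ^ (d - 1) * (|deriv U r| ^ (p - 2) * (f r ^ 2 / r ^ 2))) := by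
  have hp' : 0 < p - 1 := by linarith
  have hT : 0 ≤ (β + 1) * p := by positivity
  have he0 : 0 < d - 2 + (κ - 1) * p + 2 * α := by
    refine pos_of_mul_pos_left (b := p - 1) ?_ hp'.le
    have : (d - 2 + (κ - 1) * p + 2 * α) * (p - 1) =
        (1 - α) * ((d - 2) * (p - 1) + p) + α * ((d - p) * (p - 1)) := by
      linear_combination p * hκp
    rw [this]
    have h1 : 0 ≤ (d - 2) * (p - 1) := mul_nonneg (by linarith) hp'.le
    have h2 : 0 ≤ α * ((d - p) * (p - 1)) :=
      mul_nonneg hα0 (mul_nonneg (by linarith) hp'.le)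
    have h3 : 0 < (1 - α) * ((d - 2) * (p - 1) + p) := mul_pos (by linarith) (by linarith)
    linarith
  have heinf : d - 2 + (κ - 1) * p + 2 * α - κ * ((β + 1) * p) < 0 := by
    refine neg_of_mul_neg_left (b := p - 1) ?_ hp'.le
    have : (d - 2 + (κ - 1) * p + 2 * α - κ * ((β + 1) * p)) * (p - 1) =
        -(2 * (1 - α) * (p - 1)) - (d - p) := by
      linear_combination (-p) * hβp
    rw [this]
    have : 0 < 2 * (1 - α) * (p - 1) := mul_pos (by linarith) hp'
    linarith
  have hb0 : 0 < d + (σ - 1) * q + 2 * (κ - 1 + α) := by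
    refine pos_of_mul_pos_left (b := p - 1) ?_ hp'.le
    have : (d + (σ - 1) * q + 2 * (κ - 1 + α)) * (p - 1) =
        (1 - α) * (d * (p - 1) + 2) + α * ((d - p) * (p - 1)) := by
      linear_combination 2 * hκp + (p - 1) * hαp
    rw [this]
    have h1 : 0 ≤ d * (p - 1) := mul_nonneg (by linarith) hp'.le
    have h2 : 0 ≤ α * ((d - p) * (p - 1)) :=
      mul_nonneg hα0 (mul_nonneg (by linarith) hp'.le)
    have h3 : 0 < (1 - α) * (d * (p - 1) + 2) := mul_pos (by linarith) (by linarith)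
    linarith
  have hbinf : d + (σ - 1) * q + 2 * (κ - 1 + α) - κ * (β * q + 2) < 0 := by
    refine neg_of_mul_neg_left (b := p - 1) ?_ hp'.le
    have : (d + (σ - 1) * q + 2 * (κ - 1 + α) - κ * (β * q + 2)) * (p - 1) =
        -(2 * (1 - α) * (p - 1)) - (d - α * p) := by
      linear_combination (-q) * hβp - hqd + (p - 1) * hαp
    rw [this]
    have h1 : 0 < 2 * (1 - α) * (p - 1) := mul_pos (by linarith) hp'
    have h2 : α * p ≤ p := mul_le_of_le_one_left (by linarith) hα1.le
    linarith
  have hbase : IntegrableOn (fun r : ℝ => r ^ (d - 3 + (κ - 1) * p + 2 * α) *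
      (1 + r ^ κ) ^ (-((β + 1) * p))) (Ioi 0) :=
    integrableOn_profile hT (by linarith) (by linarith)
  have hMeq : EqOn (fun r => r ^ (d - 1) * (|deriv U r| ^ (p - 2) * (f r ^ 2 / r ^ 2)))
      (fun r => (C * β * κ) ^ 2 * ((C * β * κ) ^ (p - 2) *
        (r ^ (d - 3 + (κ - 1) * p + 2 * α) * (1 + r ^ κ) ^ (-((β + 1) * p))))) (Ioi 0) := by
    intro r hr
    have hr : 0 < r := hr
    simp only
    rw [← weight_mul_sq hκ hβ hC hU hr, direction_eq hU hf hr, Real.rpow_sub_one hr.ne' (κ - 1 + α)]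
    field_simp
  have hM : IntegrableOn (fun r => r ^ (d - 1) * (|deriv U r| ^ (p - 2) * (f r ^ 2 / r ^ 2)))
      (Ioi 0) :=
    (integrableOn_congr_fun hMeq measurableSet_Ioi).2 ((hbase.const_mul _).const_mul _)
  have hA : IntegrableOn
      (fun r => r ^ (d - 1) * (|deriv U r| ^ (p - 2) * ((p - 1) * deriv f r ^ 2))) (Ioi 0) := by
    refine ((hbase.const_mul ((C * β * κ) ^ (p - 2))).const_mul ((p - 1) *
      (C * β * κ * (|κ - 1 + α| + κ * (β + 1))) ^ 2)).mono'
      (Measurable.aestronglyMeasurable ?_) ?_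
    · have := measurable_deriv U
      have := measurable_deriv f
      fun_prop
    · filter_upwards [ae_restrict_mem measurableSet_Ioi] with r hr
      have hr : 0 < r := hr
      have ha : 0 ≤ |deriv U r| ^ (p - 2) := Real.rpow_nonneg (abs_nonneg _) _
      have hd' : 0 ≤ r ^ (d - 1) := Real.rpow_nonneg hr.le _
      rw [Real.norm_of_nonneg (by positivity), ← weight_mul_sq hκ hβ hC hU hr]
      have hle : deriv f r ^ 2 ≤ (C * β * κ * (|κ - 1 + α| + κ * (β + 1)) *
          (r ^ (κ - 1 + α - 1) * (1 + r ^ κ) ^ (-(β + 1)))) ^ 2 := by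
        rw [← sq_abs (deriv f r)]
        exact pow_le_pow_left₀ (abs_nonneg _) (abs_deriv_direction_le hκ hβ hC hU hf hr) 2
      calc _ = r ^ (d - 1) * |deriv U r| ^ (p - 2) * (p - 1) * deriv f r ^ 2 := by ring
        _ ≤ r ^ (d - 1) * |deriv U r| ^ (p - 2) * (p - 1) *
          (C * β * κ * (|κ - 1 + α| + κ * (β + 1)) *
          (r ^ (κ - 1 + α - 1) * (1 + r ^ κ) ^ (-(β + 1)))) ^ 2 :=
          mul_le_mul_of_nonneg_left hle (by positivity)
        _ = _ := by ring
  have hB : IntegrableOn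
      (fun r => r ^ (d - 1) * (r ^ ((σ - 1) * q) * U r ^ (q - 2) * f r ^ 2)) (Ioi 0) := by
    refine (integrableOn_congr_fun (fun r hr => potential_mul_sq hC hU hf hr)
      measurableSet_Ioi).2 (Integrable.const_mul ?_ _)
    exact integrableOn_profile (by positivity) (by linarith) (by linarith)
  refine ⟨hM, ?_, hA, hB, ?_⟩
  · have hpos : ∀ r ∈ Ioi (0 : ℝ),
        0 < r ^ (d - 1) * (|deriv U r| ^ (p - 2) * (f r ^ 2 / r ^ 2)) := by
      intro r hr
      have h := hMeq hr
      simp only at h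
      rw [h]
      exact mul_pos (by positivity) (mul_pos (by positivity) (profile_pos hr))
    rw [setIntegral_pos_iff_support_of_nonneg_ae _ hM]
    · refine lt_of_lt_of_le ?_ (measure_mono (s := Ioi (0 : ℝ))
        fun r hr => ⟨(hpos r hr).ne', hr⟩)
      simp
    · filter_upwards [ae_restrict_mem measurableSet_Ioi] with r hr using (hpos r hr).le
  set Φ : ℝ → ℝ := fun s =>
    (p - 1) * (s ^ (d - 1) * |deriv U s| ^ (p - 2)) * deriv f s * f s with hΦ
  have hΦle : ∀ r ∈ Ioi (0 : ℝ), |Φ r| ≤ (p - 1) * (C * β * κ * (|κ - 1 + α| + κ * (β + 1))) *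
      (C * β * κ) * (C * β * κ) ^ (p - 2) *
      (r ^ (d - 2 + (κ - 1) * p + 2 * α) * (1 + r ^ κ) ^ (-((β + 1) * p))) := by
    intro r hr
    have hr : 0 < r := hr
    have hκr := Real.rpow_pos_of_pos hr κ
    have ha : 0 ≤ |deriv U r| ^ (p - 2) := Real.rpow_nonneg (abs_nonneg _) _
    have hd' : 0 ≤ r ^ (d - 1) := Real.rpow_nonneg hr.le _
    have hpr : 0 < r ^ (κ - 1 + α) * (1 + r ^ κ) ^ (-(β + 1)) := profile_pos hr
    have hfa : |f r| = C * β * κ * (r ^ (κ - 1 + α) * (1 + r ^ κ) ^ (-(β + 1))) := by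
      rw [direction_eq hU hf hr, abs_neg, abs_of_pos (by positivity)]
    have h1 : r ^ (d - 2 + (κ - 1) * p + 2 * α) = r ^ (d - 3 + (κ - 1) * p + 2 * α) * r := by
      rw [← Real.rpow_add_one hr.ne']; congr 1; ring
    have h2 : r ^ (κ - 1 + α) = r ^ (κ - 1 + α - 1) * r := by
      rw [← Real.rpow_add_one hr.ne']; congr 1; ring
    simp only [hΦ]
    rw [abs_mul, abs_mul, hfa, abs_of_nonneg (by positivity)]
    calc _ ≤ (p - 1) * (r ^ (d - 1) * |deriv U r| ^ (p - 2)) *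
          (C * β * κ * (|κ - 1 + α| + κ * (β + 1)) *
            (r ^ (κ - 1 + α - 1) * (1 + r ^ κ) ^ (-(β + 1)))) *
          (C * β * κ * (r ^ (κ - 1 + α) * (1 + r ^ κ) ^ (-(β + 1)))) := by
          gcongr
          exact abs_deriv_direction_le hκ hβ hC hU hf hr
      _ = (p - 1) * (C * β * κ * (|κ - 1 + α| + κ * (β + 1))) * (C * β * κ) * r *
          (r ^ (d - 1) * |deriv U r| ^ (p - 2) *
            (r ^ (κ - 1 + α - 1) * (1 + r ^ κ) ^ (-(β + 1))) ^ 2) := by rw [h2]; ring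
      _ = _ := by rw [weight_mul_sq hκ hβ hC hU hr, h1]; ring
  have hΦinf : Tendsto Φ atTop (𝓝 0) := by
    refine squeeze_zero_norm' ?_ ?_ (a := fun r => (p - 1) *
      (C * β * κ * (|κ - 1 + α| + κ * (β + 1))) * (C * β * κ) * (C * β * κ) ^ (p - 2) *
      (r ^ (d - 2 + (κ - 1) * p + 2 * α) * (1 + r ^ κ) ^ (-((β + 1) * p))))
    · filter_upwards [Ioi_mem_atTop 0] with r hr using hΦle r hr
    · simpa using (tendsto_profile_atTop hT heinf).const_mul ((p - 1) *
        (C * β * κ * (|κ - 1 + α| + κ * (β + 1))) * (C * β * κ) * (C * β * κ) ^ (p - 2))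
  have hΦzero : Tendsto Φ (𝓝[>] 0) (𝓝 0) := by
    refine squeeze_zero_norm' ?_ ?_ (a := fun r => (p - 1) *
      (C * β * κ * (|κ - 1 + α| + κ * (β + 1))) * (C * β * κ) * (C * β * κ) ^ (p - 2) *
      (r ^ (d - 2 + (κ - 1) * p + 2 * α) * (1 + r ^ κ) ^ (-((β + 1) * p))))
    · filter_upwards [self_mem_nhdsWithin] with r hr using hΦle r hr
    · simpa using (tendsto_profile_nhdsGT_zero (κ := κ) hT he0).const_mul ((p - 1) *
        (C * β * κ * (|κ - 1 + α| + κ * (β + 1))) * (C * β * κ) * (C * β * κ) ^ (p - 2))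
  have hcont : ContinuousWithinAt (Function.update Φ 0 0) (Ici 0) 0 := by
    rw [continuousWithinAt_update_same, Ici_sdiff_left]
    exact hΦzero
  have hder : ∀ r ∈ Ioi (0 : ℝ), HasDerivAt (Function.update Φ 0 0) _ r := fun r hr =>
    (hasDerivAt_flux_mul hU3 hUpos hU' hODE hf hαp hr).congr_of_eventuallyEq (by
      filter_upwards [Ioi_mem_nhds hr] with s hs
      rw [Function.update_of_ne (ne_of_gt hs)])
  have hlim : Tendsto (Function.update Φ 0 0) atTop (𝓝 0) := by
    refine hΦinf.congr' ?_
    filter_upwards [Ioi_mem_atTop 0] with s hs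
    rw [Function.update_of_ne (ne_of_gt hs)]
  have hint := integral_Ioi_of_hasDerivAt_of_tendsto hcont hder
    ((hA.sub (hB.const_mul (q - 1))).add (hM.const_mul ((1 - α) * (d - 1 - α * (p - 1))))) hlim
  rw [Function.update_self, sub_zero] at hint
  have hsplit := integral_add (hA.sub (hB.const_mul (q - 1)))
    (hM.const_mul ((1 - α) * (d - 1 - α * (p - 1))))
  have hsplit' := integral_sub hA (hB.const_mul (q - 1))
  rw [integral_const_mul] at hsplit'
  rw [integral_const_mul] at hsplit
  simp only [Pi.sub_apply] at hsplit
  linarith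

end RadialIntegrals

/-- Negativity of the second variation of the energy functional at the
radial solution `U` in the direction `h(x) = f(|x|)g(x)`, whenever the Rayleigh quotient
of `g` on `D` is bounded by some `λ < λ* = (1-α)(n-1-α(p-1))`. -/
theorem statement16 (n : ℕ) (hn : 2 ≤ n) (p σ q α lamstar : ℝ) (hp1 : 1 < p)
    (hpn : p < (n : ℝ)) (hσ0 : 0 < σ) (hσ1 : σ ≤ 1) (hq : q = n * p / (n - σ * p))
    (hα : α = (1 - σ) * q / p)
    (hls : lamstar = (1 - α) * ((n : ℝ) - 1 - α * (p - 1)))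
    (U : ℝ → ℝ) (hU3 : ContDiffOn ℝ 3 U (Set.Ioi 0))
    (hUpos : ∀ r ∈ Set.Ioi (0 : ℝ), 0 < U r) (hU' : ∀ r ∈ Set.Ioi (0 : ℝ), deriv U r < 0)
    (hODE : ∀ r ∈ Set.Ioi (0 : ℝ),
      deriv (fun s => s ^ ((n : ℝ) - 1) * |deriv U s| ^ (p - 2) * deriv U s) r
        = -(r ^ ((n : ℝ) - 1 + (σ - 1) * q) * (U r) ^ (q - 1)))
    (hUw : ∃ C : ℝ, 0 < C ∧ ∀ r ∈ Set.Ioi (0 : ℝ),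
      U r = C * (1 + r ^ (σ * ((n : ℝ) - p) * q / (n * (p - 1)))) ^ (-(n : ℝ) / (σ * q)))
    (f : ℝ → ℝ) (hf : f = fun r => r ^ α * deriv U r)
    (D : Set (Euc n)) (hne : D.Nonempty) (hop : IsOpenInSphere D)
    (g : Euc n → ℝ) (hg : ContDiffOn ℝ 1 g {(0 : Euc n)}ᶜ) (hhom : IsZeroHomog g)
    (hgne : ∃ x ∈ D, g x ≠ 0)
    (lam : ℝ) (hlam0 : 0 ≤ lam) (hlam : lam < lamstar)
    (hray : (∫ x in D, ‖gradient g x‖ ^ 2 ∂sphereMeasure n)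
        ≤ lam * ∫ x in D, (g x) ^ 2 ∂sphereMeasure n) :
    IntegrableOn (fun x : Euc n => |deriv U ‖x‖| ^ (p - 2)
        * ((p - 1) * (deriv f ‖x‖) ^ 2 * (g x) ^ 2 + (f ‖x‖) ^ 2 * ‖gradient g x‖ ^ 2))
      (cone D) volume ∧
    IntegrableOn (fun x : Euc n => ‖x‖ ^ ((σ - 1) * q) * (U ‖x‖) ^ (q - 2)
        * (f ‖x‖) ^ 2 * (g x) ^ 2) (cone D) volume ∧
    (∫ x in cone D, |deriv U ‖x‖| ^ (p - 2)
        * ((p - 1) * (deriv f ‖x‖) ^ 2 * (g x) ^ 2 + (f ‖x‖) ^ 2 * ‖gradient g x‖ ^ 2))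
      - (q - 1) * ∫ x in cone D, ‖x‖ ^ ((σ - 1) * q) * (U ‖x‖) ^ (q - 2)
          * (f ‖x‖) ^ 2 * (g x) ^ 2 < 0 := by
  obtain ⟨C, hC, hUC⟩ := hUw
  have hn2 : (2 : ℝ) ≤ n := by exact_mod_cast hn
  have hn0 : (0 : ℝ) < n := by linarith
  have hp0 : 0 < p := by linarith
  have hp' : 0 < p - 1 := by linarith
  have hnp : 0 < (n : ℝ) - p := by linarith
  have hσp : 0 < (n : ℝ) - σ * p := by
    have : σ * p ≤ p := mul_le_of_le_one_left hp0.le hσ1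
    linarith
  have hq0 : 0 < q := by rw [hq]; positivity
  have hqσ : q * (n - σ * p) = n * p := by rw [hq, div_mul_cancel₀ _ hσp.ne']
  have hαp : α * p = (1 - σ) * q := by rw [hα]; field_simp
  have hqd : ((n : ℝ) - p) * q = p * (n - α * p) := by linear_combination hqσ + p * hαp
  have hα0 : 0 ≤ α := by
    rw [hα]; exact div_nonneg (mul_nonneg (by linarith) hq0.le) hp0.le
  set κ : ℝ := σ * ((n : ℝ) - p) * q / (n * (p - 1)) with hκ
  have hκ0 : 0 < κ := by positivity
  have hκn : κ * (n * (p - 1)) = σ * ((n : ℝ) - p) * q := by rw [hκ]; field_simp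
  have hκp : κ * (p - 1) = p * (1 - α) := by
    refine mul_left_cancel₀ hn0.ne' ?_
    linear_combination hκn + hqσ + n * hαp
  have hα1 : α < 1 := by
    have h : 0 < p * (1 - α) := hκp ▸ mul_pos hκ0 hp'
    linarith [pos_of_mul_pos_right h hp0.le]
  have hβ0 : 0 < (n : ℝ) / (σ * q) := by positivity
  have hβp : κ * (n / (σ * q)) * (p - 1) = n - p := by rw [hκ]; field_simp
  simp only [neg_div] at hUC
  obtain ⟨hM, hMpos, hA, hB, hAB⟩ := radial_second_variation hp1 hpn hn2 hα0 hα1 hq0 hαp hqd hκ0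
    hκp hβ0 hβp hC hUC hU3 hUpos hU' hODE hf
  have hg2 : ContinuousOn (fun x => g x ^ 2) {(0 : Euc n)}ᶜ := hg.continuousOn.pow 2
  have hgr : ContinuousOn (fun x => ‖gradient g x‖ ^ 2) {(0 : Euc n)}ᶜ :=
    (continuousOn_norm_gradient hg).pow 2
  have hg2pos : 0 < ∫ x in D, g x ^ 2 ∂sphereMeasure n := by
    obtain ⟨x, hx, hgx⟩ := hgne
    exact setIntegral_sphereMeasure_pos hop hg2 (fun _ => sq_nonneg _) ⟨x, hx, pow_ne_zero 2 hgx⟩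
  have hn1 : 1 ≤ n := by omega
  obtain ⟨iA, eA⟩ := integrableOn_cone_and_integral hn1 hop hA (integrableOn_sphereMeasure hop hg2)
  obtain ⟨iM, eM⟩ := integrableOn_cone_and_integral hn1 hop hM (integrableOn_sphereMeasure hop hgr)
  obtain ⟨iB, eB⟩ := integrableOn_cone_and_integral hn1 hop hB (integrableOn_sphereMeasure hop hg2)
  have hm := measurableSet_cone hop
  have hgx : ∀ x ∈ cone D, x ≠ 0 ∧ g (‖x‖⁻¹ • x) = g x := fun x hx => by
    have h0 := ((mem_cone_iff hop.1 x).1 hx).1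
    exact ⟨h0, hhom _ (inv_pos.2 (norm_pos_iff.2 h0)) x h0⟩
  have h1 : EqOn (fun x : Euc n => |deriv U ‖x‖| ^ (p - 2)
      * ((p - 1) * (deriv f ‖x‖) ^ 2 * (g x) ^ 2 + (f ‖x‖) ^ 2 * ‖gradient g x‖ ^ 2))
      (fun x => |deriv U ‖x‖| ^ (p - 2) * ((p - 1) * deriv f ‖x‖ ^ 2) * g (‖x‖⁻¹ • x) ^ 2 +
        |deriv U ‖x‖| ^ (p - 2) * (f ‖x‖ ^ 2 / ‖x‖ ^ 2) * ‖gradient g (‖x‖⁻¹ • x)‖ ^ 2)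
      (cone D) := by
    intro x hx
    obtain ⟨h0, hx⟩ := hgx x hx
    simp only
    rw [hx, norm_gradient_of_isZeroHomog hhom h0]
    ring
  have h2 : EqOn (fun x : Euc n => ‖x‖ ^ ((σ - 1) * q) * (U ‖x‖) ^ (q - 2)
        * (f ‖x‖) ^ 2 * (g x) ^ 2)
      (fun x => ‖x‖ ^ ((σ - 1) * q) * U ‖x‖ ^ (q - 2) * f ‖x‖ ^ 2 * g (‖x‖⁻¹ • x) ^ 2)
      (cone D) := by
    intro x hx
    simp only
    rw [(hgx x hx).2]
  refine ⟨(integrableOn_congr_fun h1 hm).2 (iA.add iM), (integrableOn_congr_fun h2 hm).2 iB, ?_⟩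
  rw [setIntegral_congr_fun hm h1, setIntegral_congr_fun hm h2, integral_add iA iM, eA, eM, eB]
  rw [← hls] at hAB
  set M := ∫ r in Ioi (0 : ℝ), r ^ ((n : ℝ) - 1) * (|deriv U r| ^ (p - 2) * (f r ^ 2 / r ^ 2))
  set G := ∫ x in D, g x ^ 2 ∂sphereMeasure n
  set H := ∫ x in D, ‖gradient g x‖ ^ 2 ∂sphereMeasure n
  have h3 : M * H ≤ M * (lam * G) := mul_le_mul_of_nonneg_left hray hMpos.le
  have h4 : 0 < M * ((lamstar - lam) * G) :=
    mul_pos hMpos (mul_pos (by linarith) hg2pos)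
  linear_combination h3 + h4 + G * hAB
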